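/- Let R be a Cohen–Macaulay local ring with canonical module ω, and M a finitely generated R-module. Then Tr M is maximal Cohen–Macaulay if and only if M ⊗_R ω is maximal Cohen–Macaulay. -/

import Mathlib

open CategoryTheory TensorProduct IsLocalRing

noncomputable section

/-- The `n`-th Ext group of two `R`-modules. -/
abbrev extGroup (R : Type) [CommRing R] (n : ℕ) (M N : Type) [AddCommGroup M] [Module R M]
    [AddCommGroup N] [Module R N] : Type :=
  ((Ext R (ModuleCat R) n).obj (Opposite.op (ModuleCat.of R M))).obj (ModuleCat.of R N)

/-- The `n`-th Tor group of two `R`-modules. -/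
abbrev torGroup (R : Type) [CommRing R] (n : ℕ) (M N : Type) [AddCommGroup M] [Module R M]
    [AddCommGroup N] [Module R N] : Type :=
  ((Tor (ModuleCat R) n).obj (ModuleCat.of R M)).obj (ModuleCat.of R N)

/-- The depth of a module over a local ring, as the infimum of the degrees in which
`Ext(k, N)` is nonzero. -/
def moduleDepth (R : Type) [CommRing R] [IsLocalRing R] (N : Type) [AddCommGroup N]
    [Module R N] : ℕ∞ :=
  sInf {n : ℕ∞ | ∃ k : ℕ, n = k ∧
    Nontrivial (extGroup R k (R ⧸ IsLocalRing.maximalIdeal R) N)}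

/-- A module is maximal Cohen–Macaulay if `depth M_p = dim R_p` for all `p` in the support. -/
def IsMCM (R : Type) [CommRing R] (M : Type) [AddCommGroup M] [Module R M] : Prop :=
  ∀ p : PrimeSpectrum R, Nontrivial (LocalizedModule p.asIdeal.primeCompl M) →
    (moduleDepth (Localization.AtPrime p.asIdeal)
        (LocalizedModule p.asIdeal.primeCompl M) : WithBot ℕ∞) =
      ringKrullDim (Localization.AtPrime p.asIdeal)

/-- A local ring is Cohen–Macaulay if its depth equals its Krull dimension. -/
def IsCMLocal (R : Type) [CommRing R] [IsLocalRing R] : Prop :=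
  (moduleDepth R R : WithBot ℕ∞) = ringKrullDim R

/-- Injective dimension at most `n`, defined recursively via cosyzygies. -/
def hasInjDimLE (R : Type) [CommRing R] : ℕ → ∀ (M : Type) [AddCommGroup M] [Module R M], Prop
  | 0, M, _, _ => Module.Injective R M
  | (n+1), M, _, _ => ∃ (I : Type) (_ : AddCommGroup I) (_ : Module R I) (f : M →ₗ[R] I),
      Module.Injective R I ∧ Function.Injective f ∧
        hasInjDimLE R n (I ⧸ LinearMap.range f)

/-- Projective dimension at most `n`, defined recursively via syzygies. -/
def hasPdLE (R : Type) [CommRing R] : ℕ → ∀ (M : Type) [AddCommGroup M] [Module R M], Prop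
  | 0, M, _, _ => Module.Projective R M
  | (n+1), M, _, _ => ∃ (P : Type) (_ : AddCommGroup P) (_ : Module R P) (f : P →ₗ[R] M),
      Module.Projective R P ∧ Function.Surjective f ∧ hasPdLE R n (LinearMap.ker f)

/-- `ω` is a canonical module of the Cohen–Macaulay local ring `R`: it is finitely generated,
maximal Cohen–Macaulay, of finite injective dimension, and of type one. -/
def IsCanonicalModule (R : Type) [CommRing R] [IsLocalRing R] (ω : Type) [AddCommGroup ω]
    [Module R ω] : Prop :=
  Module.Finite R ω ∧ IsMCM R ω ∧ (∃ n, hasInjDimLE R n ω) ∧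
    ∃ d : ℕ, ringKrullDim R = d ∧
      Nonempty (extGroup R d (R ⧸ IsLocalRing.maximalIdeal R) ω ≃ₗ[R]
        (R ⧸ IsLocalRing.maximalIdeal R))

/-- `T` is an Auslander transpose of `M`: the cokernel of the `R`-dual of a minimal
free presentation of `M`. -/
def IsAuslanderTranspose (R : Type) [CommRing R] [IsLocalRing R] (M T : Type)
    [AddCommGroup M] [Module R M] [AddCommGroup T] [Module R T] : Prop :=
  ∃ (m n : ℕ) (f : (Fin n → R) →ₗ[R] (Fin m → R)),
    LinearMap.range f ≤ (IsLocalRing.maximalIdeal R) • (⊤ : Submodule R (Fin m → R)) ∧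
    LinearMap.ker f ≤ (IsLocalRing.maximalIdeal R) • (⊤ : Submodule R (Fin n → R)) ∧
    Nonempty (((Fin m → R) ⧸ LinearMap.range f) ≃ₗ[R] M) ∧
    Nonempty ((Module.Dual R (Fin n → R) ⧸ LinearMap.range f.dualMap) ≃ₗ[R] T)

end

/-- Vanishing of `Ext^j(N, X)`. -/
abbrev ExtVanishes (R : Type) [CommRing R] (N X : Type) [AddCommGroup N] [Module R N]
    [AddCommGroup X] [Module R X] (j : ℕ) : Prop :=
  Subsingleton (Abelian.Ext (ModuleCat.of R N) (ModuleCat.of R X) j)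

namespace ExtVanishes

section Basic

variable {R : Type} [CommRing R] {A B C N X : Type}
  [AddCommGroup A] [Module R A] [AddCommGroup B] [Module R B] [AddCommGroup C] [Module R C]
  [AddCommGroup N] [Module R N] [AddCommGroup X] [Module R X]

/-- The short exact sequence in `ModuleCat R` associated with a short exact sequence of linear
maps. -/
lemma exists_shortExact {f : A →ₗ[R] B} {g : B →ₗ[R] C} (hf : Function.Injective f)
    (hg : Function.Surjective g) (h : Function.Exact f g) :
    (ModuleCat.shortComplexOfCompEqZero f g h.linearMap_comp_eq_zero).ShortExact :=
  ModuleCat.shortComplex_shortExact _ h hf hg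

lemma of_exact_snd_mid {f : A →ₗ[R] B} {g : B →ₗ[R] C} (hf : Function.Injective f)
    (hg : Function.Surjective g) (h : Function.Exact f g) {j : ℕ}
    (hA : ExtVanishes R N A j) (hC : ExtVanishes R N C j) : ExtVanishes R N B j := by
  refine subsingleton_of_forall_eq 0 fun x ↦ ?_
  obtain ⟨y, rfl⟩ := Abelian.Ext.covariant_sequence_exact₂ (ModuleCat.of R N)
    (exists_shortExact hf hg h) x (@Subsingleton.elim _ hC _ _)
  rw [@Subsingleton.elim _ hA y 0]
  simp

lemma of_exact_snd_left {f : A →ₗ[R] B} {g : B →ₗ[R] C} (hf : Function.Injective f)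
    (hg : Function.Surjective g) (h : Function.Exact f g) {j : ℕ}
    (hB : ExtVanishes R N B (j + 1)) (hC : ExtVanishes R N C j) : ExtVanishes R N A (j + 1) := by
  refine subsingleton_of_forall_eq 0 fun x ↦ ?_
  obtain ⟨y, rfl⟩ := Abelian.Ext.covariant_sequence_exact₁ (ModuleCat.of R N)
    (exists_shortExact hf hg h) x (@Subsingleton.elim _ hB _ _) rfl
  rw [@Subsingleton.elim _ hC y 0]
  simp

lemma of_exact_snd_right {f : A →ₗ[R] B} {g : B →ₗ[R] C} (hf : Function.Injective f)
    (hg : Function.Surjective g) (h : Function.Exact f g) {j : ℕ}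
    (hB : ExtVanishes R N B j) (hA : ExtVanishes R N A (j + 1)) : ExtVanishes R N C j := by
  refine subsingleton_of_forall_eq 0 fun x ↦ ?_
  obtain ⟨y, rfl⟩ := Abelian.Ext.covariant_sequence_exact₃ (ModuleCat.of R N)
    (exists_shortExact hf hg h) x rfl (@Subsingleton.elim _ hA _ _)
  rw [@Subsingleton.elim _ hB y 0]
  simp

lemma of_exact_fst_mid {f : A →ₗ[R] B} {g : B →ₗ[R] C} (hf : Function.Injective f)
    (hg : Function.Surjective g) (h : Function.Exact f g) {j : ℕ}
    (hA : ExtVanishes R A X j) (hC : ExtVanishes R C X j) : ExtVanishes R B X j := by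
  refine subsingleton_of_forall_eq 0 fun x ↦ ?_
  obtain ⟨y, rfl⟩ := Abelian.Ext.contravariant_sequence_exact₂
    (exists_shortExact hf hg h) (ModuleCat.of R X) x (@Subsingleton.elim _ hA _ _)
  rw [@Subsingleton.elim _ hC y 0]
  simp

lemma of_exact_fst_left {f : A →ₗ[R] B} {g : B →ₗ[R] C} (hf : Function.Injective f)
    (hg : Function.Surjective g) (h : Function.Exact f g) {j : ℕ}
    (hB : ExtVanishes R B X j) (hC : ExtVanishes R C X (j + 1)) : ExtVanishes R A X j := by
  refine subsingleton_of_forall_eq 0 fun x ↦ ?_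
  obtain ⟨y, rfl⟩ := Abelian.Ext.contravariant_sequence_exact₁
    (exists_shortExact hf hg h) (ModuleCat.of R X) x (add_comm 1 j) (@Subsingleton.elim _ hC _ _)
  rw [@Subsingleton.elim _ hB y 0]
  simp

lemma of_exact_fst_right {f : A →ₗ[R] B} {g : B →ₗ[R] C} (hf : Function.Injective f)
    (hg : Function.Surjective g) (h : Function.Exact f g) {j : ℕ}
    (hB : ExtVanishes R B X (j + 1)) (hA : ExtVanishes R A X j) : ExtVanishes R C X (j + 1) := by
  refine subsingleton_of_forall_eq 0 fun x ↦ ?_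
  obtain ⟨y, rfl⟩ := Abelian.Ext.contravariant_sequence_exact₃
    (exists_shortExact hf hg h) (ModuleCat.of R X) x (@Subsingleton.elim _ hB _ _) (add_comm 1 j)
  rw [@Subsingleton.elim _ hA y 0]
  simp

lemma of_linearEquiv_snd (e : A ≃ₗ[R] B) {j : ℕ} (h : ExtVanishes R N A j) :
    ExtVanishes R N B j := by
  refine subsingleton_of_forall_eq 0 fun x ↦ ?_
  have : x = (x.comp (Abelian.Ext.mk₀ e.toModuleIso.inv) (add_zero j)).comp
      (Abelian.Ext.mk₀ e.toModuleIso.hom) (add_zero j) := by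
    rw [Abelian.Ext.comp_assoc_of_third_deg_zero, Abelian.Ext.mk₀_comp_mk₀, Iso.inv_hom_id,
      Abelian.Ext.comp_mk₀_id]
  rw [this, @Subsingleton.elim _ h (x.comp _ _) 0]
  simp

lemma of_linearEquiv_fst (e : A ≃ₗ[R] B) {j : ℕ} (h : ExtVanishes R A X j) :
    ExtVanishes R B X j := by
  refine subsingleton_of_forall_eq 0 fun x ↦ ?_
  have : x = (Abelian.Ext.mk₀ e.toModuleIso.inv).comp
      ((Abelian.Ext.mk₀ e.toModuleIso.hom).comp x (zero_add j)) (zero_add j) := by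
    rw [Abelian.Ext.mk₀_comp_mk₀_assoc, Iso.inv_hom_id, Abelian.Ext.mk₀_id_comp]
  rw [this, @Subsingleton.elim _ h (Abelian.Ext.comp _ x _) 0]
  simp

/-- `Ext⁰` is the group of linear maps. -/
noncomputable def zeroEquiv (R : Type) [CommRing R] (N X : Type) [AddCommGroup N] [Module R N]
    [AddCommGroup X] [Module R X] :
    Abelian.Ext (ModuleCat.of R N) (ModuleCat.of R X) 0 ≃ₗ[R] (N →ₗ[R] X) :=
  Abelian.Ext.linearEquiv₀.trans ModuleCat.homLinearEquiv

lemma zero_iff : ExtVanishes R N X 0 ↔ Subsingleton (N →ₗ[R] X) :=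
  (zeroEquiv R N X).toEquiv.subsingleton_congr

lemma of_exact_snd_left_zero {f : A →ₗ[R] B} (hf : Function.Injective f)
    (hB : ExtVanishes R N B 0) : ExtVanishes R N A 0 := by
  rw [zero_iff] at *
  refine subsingleton_of_forall_eq 0 fun x ↦ ?_
  ext n
  apply hf
  exact (LinearMap.congr_fun (Subsingleton.elim (f ∘ₗ x) 0) n).trans (map_zero f).symm

lemma of_subsingleton_fst [Subsingleton N] {j : ℕ} : ExtVanishes R N X j := by
  have : Limits.IsZero (ModuleCat.of R N) := ModuleCat.isZero_of_subsingleton _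
  refine subsingleton_of_forall_eq 0 fun x ↦ ?_
  have h : x = (Abelian.Ext.mk₀ (𝟙 (ModuleCat.of R N))).comp x (zero_add j) := by simp
  rw [h, this.eq_of_src (𝟙 _) 0]
  simp

lemma of_subsingleton_snd [Subsingleton X] {j : ℕ} : ExtVanishes R N X j := by
  have : Limits.IsZero (ModuleCat.of R X) := ModuleCat.isZero_of_subsingleton _
  refine subsingleton_of_forall_eq 0 fun x ↦ ?_
  have h : x = x.comp (Abelian.Ext.mk₀ (𝟙 (ModuleCat.of R X))) (add_zero j) := by simp
  rw [h, this.eq_of_src (𝟙 _) 0]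
  simp

lemma of_projective [Module.Projective R N] (j : ℕ) : ExtVanishes R N X (j + 1) :=
  have := (IsProjective.iff_projective N).mp ‹_›
  Abelian.Ext.subsingleton_of_projective (ModuleCat.of R N) (ModuleCat.of R X) j

lemma of_injective (h : Module.Injective R X) (j : ℕ) : ExtVanishes R N X (j + 1) :=
  have := (Module.injective_iff_injective_object R X).mp h
  subsingleton_of_forall_eq 0 Abelian.Ext.eq_zero_of_injective

lemma prod_snd {j : ℕ} (hA : ExtVanishes R N A j) (hB : ExtVanishes R N B j) :
    ExtVanishes R N (A × B) j :=
  of_exact_snd_mid LinearMap.inl_injective LinearMap.snd_surjective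
    (LinearMap.exact_iff.mpr (LinearMap.ker_snd R A B)) hA hB

lemma pi_snd (n : ℕ) {j : ℕ} (hA : ExtVanishes R N A j) : ExtVanishes R N (Fin n → A) j := by
  induction n with
  | zero => exact of_subsingleton_snd
  | succ n ih => exact of_linearEquiv_snd (Fin.consLinearEquiv R fun _ ↦ A) (prod_snd hA ih)

/-- If `Ext¹(C, X) = 0`, linear maps to `X` extend along injections with cokernel `C`. -/
lemma exists_extension {f : A →ₗ[R] B} {g : B →ₗ[R] C} (hf : Function.Injective f)
    (hg : Function.Surjective g) (h : Function.Exact f g) (hC : ExtVanishes R C X 1)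
    (φ : A →ₗ[R] X) : ∃ ψ : B →ₗ[R] X, ψ ∘ₗ f = φ := by
  obtain ⟨y, hy⟩ := Abelian.Ext.contravariant_sequence_exact₁
    (exists_shortExact hf hg h) (ModuleCat.of R X) (Abelian.Ext.mk₀ (ModuleCat.ofHom φ))
    (add_comm 1 0) (@Subsingleton.elim _ hC _ _)
  obtain ⟨ψ, rfl⟩ := (Abelian.Ext.mk₀_bijective _ _).2 y
  refine ⟨ψ.hom, ?_⟩
  rw [Abelian.Ext.mk₀_comp_mk₀] at hy
  simpa using! congrArg ModuleCat.Hom.hom ((Abelian.Ext.mk₀_bijective _ _).1 hy)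

/-- If `B` is projective and maps `A → X` extend to `B`, then `Ext¹(C, X) = 0`. -/
lemma one_of_forall_extension [Module.Projective R B] {f : A →ₗ[R] B} {g : B →ₗ[R] C}
    (hf : Function.Injective f)
    (hg : Function.Surjective g) (h : Function.Exact f g)
    (H : ∀ φ : A →ₗ[R] X, ∃ ψ : B →ₗ[R] X, ψ ∘ₗ f = φ) : ExtVanishes R C X 1 := by
  refine subsingleton_of_forall_eq 0 fun x ↦ ?_
  obtain ⟨y, rfl⟩ := Abelian.Ext.contravariant_sequence_exact₃
    (exists_shortExact hf hg h) (ModuleCat.of R X) x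
    (@Subsingleton.elim _ (of_projective 0) _ _) (add_comm 1 0)
  obtain ⟨φ, rfl⟩ := (Abelian.Ext.mk₀_bijective _ _).2 y
  obtain ⟨ψ, hψ⟩ := H φ.hom
  have : φ = (ModuleCat.shortComplexOfCompEqZero f g h.linearMap_comp_eq_zero).f ≫
      ModuleCat.ofHom ψ := by
    ext1; exact hψ.symm
  rw [this, ← Abelian.Ext.mk₀_comp_mk₀]
  exact (exists_shortExact hf hg h).extClass_comp_assoc _

end Basic

end ExtVanishes

namespace ExtVanishes

section Regular

variable {R : Type} [CommRing R] {N X Y : Type}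
  [AddCommGroup N] [Module R N] [AddCommGroup X] [Module R X] [AddCommGroup Y] [Module R Y]

/-- The quotient `Y / xY` by a principal submodule. -/
abbrev quotSMul (x : R) (Y : Type) [AddCommGroup Y] [Module R Y] : Type :=
  Y ⧸ LinearMap.range (LinearMap.lsmul R Y x)

lemma exact_lsmul_mkQ (x : R) : Function.Exact (LinearMap.lsmul R Y x)
    (LinearMap.range (LinearMap.lsmul R Y x)).mkQ :=
  LinearMap.exact_map_mkQ_range _

lemma lsmul_injective {x : R} (h : IsSMulRegular Y x) :
    Function.Injective (LinearMap.lsmul R Y x) := h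

lemma smul_mk₀_lsmul_comp (x : R) {j : ℕ}
    (α : Abelian.Ext (ModuleCat.of R N) (ModuleCat.of R X) j) :
    (Abelian.Ext.mk₀ (ModuleCat.ofHom (LinearMap.lsmul R N x))).comp α (zero_add j) = x • α := by
  have : ModuleCat.ofHom (LinearMap.lsmul R N x) = x • 𝟙 (ModuleCat.of R N) := rfl
  rw [this, Abelian.Ext.mk₀_smul, Abelian.Ext.smul_comp, Abelian.Ext.mk₀_id_comp]

lemma smul_comp_mk₀_lsmul (x : R) {j : ℕ}
    (α : Abelian.Ext (ModuleCat.of R N) (ModuleCat.of R X) j) :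
    α.comp (Abelian.Ext.mk₀ (ModuleCat.ofHom (LinearMap.lsmul R X x))) (add_zero j) = x • α := by
  have : ModuleCat.ofHom (LinearMap.lsmul R X x) = x • 𝟙 (ModuleCat.of R X) := rfl
  rw [this, Abelian.Ext.mk₀_smul, Abelian.Ext.comp_smul, Abelian.Ext.comp_mk₀_id]

lemma smul_eq_zero_of_annihilates {x : R} (hx : ∀ n : N, x • n = 0) {j : ℕ}
    (α : Abelian.Ext (ModuleCat.of R N) (ModuleCat.of R X) j) : x • α = 0 := by
  rw [← smul_mk₀_lsmul_comp]
  have : LinearMap.lsmul R N x = 0 := by ext n; exact hx n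
  simp [this]

/-- If `x` is in the Jacobson radical and regular on `N`, and `Ext^(j+1)(N/xN, X) = 0`, then
`Ext^j(N, X) = 0` by Nakayama's lemma. -/
lemma of_quotSMul_fst [IsNoetherianRing R] [IsLocalRing R] [Module.Finite R N] [Module.Finite R X]
    {x : R} (hx : x ∈ maximalIdeal R) (hreg : IsSMulRegular N x) {j : ℕ}
    (h : ExtVanishes R (quotSMul x N) X (j + 1)) : ExtVanishes R N X j := by
  have hfin : Module.Finite R (Abelian.Ext (ModuleCat.of R N) (ModuleCat.of R X) j) :=
    ModuleCat.finite_ext R _ _ j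
  rw [ExtVanishes, ← Submodule.subsingleton_iff R, ← subsingleton_iff_bot_eq_top, eq_comm]
  refine Submodule.eq_bot_of_le_smul_of_le_jacobson_bot (maximalIdeal R) ⊤ hfin.1 ?_
    (maximalIdeal_le_jacobson ⊥)
  intro α _
  obtain ⟨β, rfl⟩ := Abelian.Ext.contravariant_sequence_exact₁
    (exists_shortExact (lsmul_injective hreg) (Submodule.mkQ_surjective _) (exact_lsmul_mkQ x))
    (ModuleCat.of R X) α (add_comm 1 j) (@Subsingleton.elim _ h _ _)
  exact (smul_mk₀_lsmul_comp x β) ▸ Submodule.smul_mem_smul hx trivial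

/-- If `x` kills `N`, is regular on `Y`, and `Ext^j(N, Y/xY) = 0`, then `Ext^(j+1)(N, Y) = 0`. -/
lemma succ_of_quotSMul_snd {x : R} (hx : ∀ n : N, x • n = 0) (hreg : IsSMulRegular Y x) {j : ℕ}
    (h : ExtVanishes R N (quotSMul x Y) j) : ExtVanishes R N Y (j + 1) := by
  refine subsingleton_of_forall_eq 0 fun α ↦ ?_
  obtain ⟨y, rfl⟩ := Abelian.Ext.covariant_sequence_exact₁ (ModuleCat.of R N)
    (exists_shortExact (lsmul_injective hreg) (Submodule.mkQ_surjective _) (exact_lsmul_mkQ x)) α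
    ((smul_comp_mk₀_lsmul x α).trans (smul_eq_zero_of_annihilates hx α)) rfl
  rw [@Subsingleton.elim _ h y 0]
  simp

lemma quotSMul_snd {x : R} (hreg : IsSMulRegular Y x) {j : ℕ}
    (h : ExtVanishes R N Y j) (h' : ExtVanishes R N Y (j + 1)) :
    ExtVanishes R N (quotSMul x Y) j :=
  of_exact_snd_right (lsmul_injective hreg) (Submodule.mkQ_surjective _) (exact_lsmul_mkQ x) h h'

lemma quotSMul_fst {x : R} (hreg : IsSMulRegular N x) {j : ℕ}
    (h : ExtVanishes R N X (j + 1)) (h' : ExtVanishes R N X j) :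
    ExtVanishes R (quotSMul x N) X (j + 1) :=
  of_exact_fst_right (lsmul_injective hreg) (Submodule.mkQ_surjective _) (exact_lsmul_mkQ x) h h'

lemma exists_isSMulRegular [IsNoetherianRing R] [IsLocalRing R] [Module.Finite R Y]
    (h : ExtVanishes R (R ⧸ maximalIdeal R) Y 0) :
    ∃ x ∈ maximalIdeal R, IsSMulRegular Y x := by
  obtain ⟨r, hr, hreg⟩ := IsSMulRegular.subsingleton_linearMap_iff.mp (zero_iff.mp h)
  rw [Ideal.annihilator_quotient] at hr
  exact ⟨r, hr, hreg⟩

/-- Vanishing of `Ext^j(-, X)` may be tested on the prime cyclic modules in a closed set. -/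
lemma of_forall_prime [IsNoetherianRing R] [Module.Finite R N] (I : Ideal R) {j : ℕ}
    (h : ∀ q : PrimeSpectrum R, I ≤ q.asIdeal → ExtVanishes R (R ⧸ q.asIdeal) X j)
    (hI : I ≤ Module.annihilator R N) : ExtVanishes R N X j := by
  revert hI
  induction ‹Module.Finite R N› using
    IsNoetherianRing.induction_on_isQuotientEquivQuotientPrime R with
  | subsingleton N => exact fun _ ↦ of_subsingleton_fst
  | quotient N p f =>
    intro hI
    refine of_linearEquiv_fst f.symm (h p ?_)
    rwa [f.annihilator_eq, Ideal.annihilator_quotient] at hI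
  | exact N₁ N₂ N₃ f g hf hg hfg h₁ h₃ =>
    intro hI
    exact of_exact_fst_mid hf hg hfg (h₁ (hI.trans (f.annihilator_le_of_injective hf)))
      (h₃ (hI.trans (g.annihilator_le_of_surjective hg)))

lemma sup_span_le_annihilator (I : Ideal R) (hI : I ≤ Module.annihilator R Y) (x : R) :
    I ⊔ Ideal.span {x} ≤ Module.annihilator R (quotSMul x Y) := by
  refine sup_le (hI.trans ((Submodule.mkQ _).annihilator_le_of_surjective
    (Submodule.mkQ_surjective _))) ((Ideal.span_singleton_le_iff_mem _).mpr ?_)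
  refine Module.mem_annihilator.mpr fun y ↦ ?_
  obtain ⟨y, rfl⟩ := Submodule.mkQ_surjective _ y
  rw [← map_smul, ← LinearMap.mem_ker, Submodule.ker_mkQ]
  exact ⟨y, rfl⟩

end Regular

end ExtVanishes

namespace ExtVanishes

section Local

variable {R : Type} [CommRing R] [IsNoetherianRing R] [IsLocalRing R] {N X Y : Type}
  [AddCommGroup N] [Module R N] [AddCommGroup X] [Module R X] [AddCommGroup Y] [Module R Y]

lemma exists_mem_maximalIdeal_notMem {p : PrimeSpectrum R} (hp : p.asIdeal ≠ maximalIdeal R) :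
    ∃ x ∈ maximalIdeal R, x ∉ p.asIdeal := by
  by_contra! h
  exact hp (le_antisymm (le_maximalIdeal p.2.ne_top) h)

lemma isSMulRegular_quotient_prime {p : PrimeSpectrum R} {x : R} (hx : x ∉ p.asIdeal) :
    IsSMulRegular (R ⧸ p.asIdeal) x := by
  refine isSMulRegular_iff_right_eq_zero_of_smul.mpr fun y hy ↦ ?_
  rw [Algebra.smul_def] at hy
  exact (mul_eq_zero.mp hy).resolve_left fun h ↦ hx (Ideal.Quotient.eq_zero_iff_mem.mp h)

/-- Ext-vanishing at a prime quotient follows from that at larger primes in the next degree. -/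
lemma quotient_prime_of_forall [Module.Finite R X] {p : PrimeSpectrum R}
    (hp : p.asIdeal ≠ maximalIdeal R) {j : ℕ}
    (h : ∀ q : PrimeSpectrum R, p < q → ExtVanishes R (R ⧸ q.asIdeal) X (j + 1)) :
    ExtVanishes R (R ⧸ p.asIdeal) X j := by
  obtain ⟨x, hx, hxp⟩ := exists_mem_maximalIdeal_notMem hp
  have hann : p.asIdeal ⊔ Ideal.span {x} ≤
      Module.annihilator R (quotSMul x (R ⧸ p.asIdeal)) :=
    sup_span_le_annihilator p.asIdeal (Ideal.annihilator_quotient (I := p.asIdeal)).ge x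
  have hV : ExtVanishes R (quotSMul x (R ⧸ p.asIdeal)) X (j + 1) := by
    refine of_forall_prime (p.asIdeal ⊔ Ideal.span {x}) (fun q hq ↦ h q ?_) hann
    refine lt_of_le_of_ne (le_sup_left.trans hq) ?_
    rintro rfl
    exact hxp (hq (Ideal.mem_sup_right (Ideal.mem_span_singleton_self x)))
  exact of_quotSMul_fst hx (isSMulRegular_quotient_prime hxp) hV

/-- Ischebeck's vanishing theorem for prime quotients. -/
lemma quotient_prime_of_coheight_lt [Module.Finite R X] {d : ℕ}
    (hX : ∀ i < d, ExtVanishes R (R ⧸ maximalIdeal R) X i) (p : PrimeSpectrum R) (j : ℕ)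
    (hj : j + Order.coheight p < d) : ExtVanishes R (R ⧸ p.asIdeal) X j := by
  induction hn : Order.coheight p using WellFoundedLT.induction generalizing p j with
  | _ n ih =>
    by_cases hp : p.asIdeal = maximalIdeal R
    · rw [hp]
      exact hX j (by exact_mod_cast lt_of_le_of_lt le_self_add hj)
    · refine quotient_prime_of_forall hp fun q hq ↦ ?_
      have hfin : Order.coheight p < ⊤ :=
        lt_of_le_of_lt le_add_self (hj.trans (ENat.natCast_lt_top d))
      have hle : Order.coheight q + 1 ≤ Order.coheight p := Order.coheight_add_one_le hq
      refine ih _ (hn ▸ ?_) q (j + 1) ?_ rfl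
      · refine lt_of_le_of_lt ?_ hj
        push_cast
        rw [add_assoc, add_comm 1]
        gcongr
      · exact Order.coheight_strictAnti hq (lt_of_le_of_lt (le_self_add.trans hle) hfin)

/-- Ext-vanishing up to degree `d` on `k` gives the same on modules killed by a power of the
maximal ideal. -/
lemma of_pow_maximalIdeal_le [Module.Finite R N] {j a : ℕ}
    (hX : ExtVanishes R (R ⧸ maximalIdeal R) X j)
    (hN : maximalIdeal R ^ a ≤ Module.annihilator R N) : ExtVanishes R N X j := by
  refine of_forall_prime _ (fun q hq ↦ ?_) hN
  rw [show q.asIdeal = maximalIdeal R from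
    le_antisymm (le_maximalIdeal q.2.ne_top) (q.2.le_of_pow_le hq)]
  exact hX

/-- A finitely generated module of depth exceeding the dimension vanishes. -/
lemma subsingleton_of_ringKrullDim_lt [Module.Finite R X] {d : ℕ} (hd : ringKrullDim R < d)
    (hX : ∀ i < d, ExtVanishes R (R ⧸ maximalIdeal R) X i) : Subsingleton X := by
  by_contra hne
  rw [not_subsingleton_iff_nontrivial] at hne
  obtain ⟨p, hp⟩ := associatedPrimes.nonempty R X
  obtain ⟨x, hx⟩ := (isAssociatedPrime_iff_exists_injective_linearMap _ _).mp hp |>.2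
  have hdim : (Order.coheight (⟨p, hp.1⟩ : PrimeSpectrum R) : WithBot ℕ∞) < d :=
    (Order.coheight_le_krullDim _).trans_lt hd
  have := quotient_prime_of_coheight_lt hX ⟨p, hp.1⟩ 0
    (by rw [Nat.cast_zero, zero_add]; exact_mod_cast hdim)
  have h0 := (zero_iff.mp this).elim x 0
  have h1 : (1 : R ⧸ p) = 0 := hx (by rw [h0]; rfl)
  exact hp.1.ne_top ((Ideal.eq_top_iff_one p).mpr (Ideal.Quotient.eq_zero_iff_mem.mp h1))

end Local

end ExtVanishes

namespace ExtVanishes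

lemma of_hasInjDimLE {R : Type} [CommRing R] (n : ℕ) (X : Type) [AddCommGroup X] [Module R X]
    (hX : hasInjDimLE R n X) (N : Type) [AddCommGroup N] [Module R N] (j : ℕ) (hj : n < j) :
    ExtVanishes R N X j := by
  induction n generalizing X j with
  | zero =>
    obtain ⟨j, rfl⟩ := Nat.exists_eq_succ_of_ne_zero hj.ne'
    exact of_injective hX j
  | succ n ih =>
    obtain ⟨I, _, _, f, hI, hf, hq⟩ := hX
    obtain ⟨j, rfl⟩ := Nat.exists_eq_succ_of_ne_zero (Nat.zero_lt_of_lt hj).ne'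
    exact of_exact_snd_left hf (Submodule.mkQ_surjective _) (LinearMap.exact_map_mkQ_range f)
      (of_injective hI j) (ih _ hq j (by omega))

end ExtVanishes

section Depth

variable {R : Type} [CommRing R] [IsNoetherianRing R] [IsLocalRing R] {N X Y : Type}
  [AddCommGroup N] [Module R N] [AddCommGroup X] [Module R X] [AddCommGroup Y] [Module R Y]

/-- The groups `Ext^i(k, X)` vanish for `i < d`. -/
abbrev DepthGE (R : Type) [CommRing R] [IsLocalRing R] (d : ℕ) (X : Type) [AddCommGroup X]
    [Module R X] : Prop :=
  ∀ i < d, ExtVanishes R (R ⧸ maximalIdeal R) X i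

/-- The groups `Ext^j(N, X)` vanish for `j > d` and all finite `N`. -/
abbrev InjBound (R : Type) [CommRing R] (d : ℕ) (X : Type) [AddCommGroup X]
    [Module R X] : Prop :=
  ∀ (N : Type) [AddCommGroup N] [Module R N] [Module.Finite R N] (j : ℕ), d < j →
    ExtVanishes R N X j

open ExtVanishes

lemma smul_residue_eq_zero {R : Type} [CommRing R] [IsLocalRing R] {x : R}
    (hx : x ∈ maximalIdeal R) (n : R ⧸ maximalIdeal R) : x • n = 0 := by
  rw [Algebra.smul_def, Ideal.Quotient.algebraMap_eq, Ideal.Quotient.eq_zero_iff_mem.mpr hx,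
    zero_mul]

lemma DepthGE.quotSMul {d : ℕ} (h : DepthGE R (d + 1) Y) {x : R} (hreg : IsSMulRegular Y x) :
    DepthGE R d (quotSMul x Y) :=
  fun i hi ↦ quotSMul_snd hreg (h i (by omega)) (h (i + 1) (by omega))

lemma exists_extVanishes_of_depthGE [Module.Finite R Y] {t s : ℕ} (h : DepthGE R t Y)
    (h' : ¬ ExtVanishes R (R ⧸ maximalIdeal R) Y t) (hs : ∀ j, s < j → ExtVanishes R Y X j) :
    ∃ (Z : Type) (_ : AddCommGroup Z) (_ : Module R Z), Module.Finite R Z ∧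
      ¬ ExtVanishes R (R ⧸ maximalIdeal R) Z 0 ∧ ∀ j, s + t < j → ExtVanishes R Z X j := by
  induction t generalizing Y s with
  | zero => exact ⟨Y, _, _, ‹_›, h', hs⟩
  | succ t ih =>
    obtain ⟨x, hx, hreg⟩ := exists_isSMulRegular (h 0 (by omega))
    obtain ⟨Z, i1, i2, h1, h2, h3⟩ := ih (s := s + 1) (h.quotSMul hreg)
      (fun H ↦ h' (succ_of_quotSMul_snd (smul_residue_eq_zero hx) hreg H)) (fun j hj ↦ by
        obtain ⟨j, rfl⟩ := Nat.exists_eq_succ_of_ne_zero (Nat.zero_lt_of_lt hj).ne'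
        exact quotSMul_fst hreg (hs _ (by omega)) (hs _ (by omega)))
    exact ⟨Z, i1, i2, h1, h2, fun j hj ↦ h3 j (by omega)⟩

/-- Over a local ring of depth `d`, finite injective dimension is at most `d`. -/
lemma InjBound.of_depth {d n : ℕ} [Module.Finite R X] (hR : DepthGE R d R)
    (hR' : ¬ ExtVanishes R (R ⧸ maximalIdeal R) R d) (hX : InjBound R n X) : InjBound R d X := by
  obtain ⟨Z, _, _, _, hZ, hZX⟩ := exists_extVanishes_of_depthGE (X := X) (s := 0) hR hR'
    fun j hj ↦ by
      obtain ⟨j, rfl⟩ := Nat.exists_eq_succ_of_ne_zero hj.ne'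
      exact of_projective j
  rw [zero_iff, not_subsingleton_iff_nontrivial] at hZ
  obtain ⟨φ, hφ⟩ := exists_ne (0 : R ⧸ maximalIdeal R →ₗ[R] Z)
  have : IsSimpleModule R (R ⧸ maximalIdeal R) :=
    isSimpleModule_iff_isCoatom.mpr (maximalIdeal.isMaximal R).out
  have hinj := φ.injective_or_eq_zero.resolve_right hφ
  suffices H : ∀ e j, d < j → n < j + e → ∀ (N : Type) [AddCommGroup N] [Module R N]
      [Module.Finite R N], ExtVanishes R N X j from
    fun N _ _ _ j hj ↦ H (n + 1) j hj (by omega) N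
  intro e
  induction e with
  | zero => exact fun j _ hj N _ _ _ ↦ hX N j hj
  | succ e ih =>
    intro j hj hje N _ _ _
    refine of_forall_prime ⊥ (fun q _ ↦ ?_) bot_le
    by_cases hq : q.asIdeal = maximalIdeal R
    · rw [hq]
      exact of_exact_fst_left hinj (Submodule.mkQ_surjective _)
        (LinearMap.exact_map_mkQ_range φ) (hZX j (by omega))
        (ih (j + 1) (by omega) (by omega) _)
    · exact quotient_prime_of_forall hq fun q' _ ↦ ih (j + 1) (by omega) (by omega) _

lemma InjBound.extVanishes {d t j : ℕ} [Module.Finite R X] [Module.Finite R Y]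
    (hX : InjBound R d X) (hY : DepthGE R t Y) (hj : d < j + t) : ExtVanishes R Y X j := by
  induction t generalizing Y j with
  | zero => exact hX Y j hj
  | succ t ih =>
    obtain ⟨x, hx, hreg⟩ := exists_isSMulRegular (hY 0 (by omega))
    exact of_quotSMul_fst hx hreg (ih (hY.quotSMul hreg) (by omega))

end Depth

section Dual

open ExtVanishes

variable {R : Type} [CommRing R] [IsNoetherianRing R] [IsLocalRing R] {A B C X Y : Type}
  [AddCommGroup A] [Module R A] [AddCommGroup B] [Module R B] [AddCommGroup C] [Module R C]
  [AddCommGroup X] [Module R X] [AddCommGroup Y] [Module R Y]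

/-- The depth lemma for the kernel of a surjection. -/
lemma DepthGE.of_exact {d : ℕ} {f : A →ₗ[R] B} {g : B →ₗ[R] C} (hf : Function.Injective f)
    (hg : Function.Surjective g) (h : Function.Exact f g) (hB : DepthGE R d B)
    (hC : DepthGE R d C) : DepthGE R d A := by
  intro i hi
  obtain _ | i := i
  · exact of_exact_snd_left_zero hf (hB 0 hi)
  · exact of_exact_snd_left hf hg h (hB _ hi) (hC i (by omega))

lemma DepthGE.ker {d : ℕ} {g : B →ₗ[R] C} (hg : Function.Surjective g) (hB : DepthGE R d B)
    (hC : DepthGE R d C) : DepthGE R d (LinearMap.ker g) :=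
  .of_exact (LinearMap.ker g).subtype_injective hg (LinearMap.exact_subtype_ker_map g) hB hC

lemma DepthGE.of_linearEquiv {d : ℕ} (e : A ≃ₗ[R] B) (h : DepthGE R d A) : DepthGE R d B :=
  fun i hi ↦ of_linearEquiv_snd e (h i hi)

lemma DepthGE.pi {d : ℕ} (n : ℕ) (h : DepthGE R d A) : DepthGE R d (Fin n → A) :=
  fun i hi ↦ pi_snd n (h i hi)

lemma LinearMap.lcomp_subtype_ker_surjective {d : ℕ} [Module.Finite R X] [Module.Finite R C]
    (hX : InjBound R d X) (hC : DepthGE R d C) {g : B →ₗ[R] C} (hg : Function.Surjective g) :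
    Function.Surjective (LinearMap.lcomp R X (LinearMap.ker g).subtype) :=
  fun φ ↦ exists_extension (LinearMap.ker g).subtype_injective hg
    (LinearMap.exact_subtype_ker_map g) (hX.extVanishes hC (by omega)) φ

/-- The canonical dual of a maximal Cohen–Macaulay module is maximal Cohen–Macaulay. -/
lemma DepthGE.linearMap {d : ℕ} [Module.Finite R X] [Module.Finite R Y] (hX : InjBound R d X)
    (hXd : DepthGE R d X) (hR : DepthGE R d R) (hY : DepthGE R d Y) :
    DepthGE R d (Y →ₗ[R] X) := by
  suffices H : ∀ j ≤ d, ∀ (Y : Type) [AddCommGroup Y] [Module R Y] [Module.Finite R Y],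
      DepthGE R d Y → DepthGE R j (Y →ₗ[R] X) from H d le_rfl Y hY
  intro j
  induction j with
  | zero => exact fun _ Y _ _ _ _ i hi ↦ by omega
  | succ j ih =>
    intro hj Y _ _ _ hY i hi
    obtain ⟨a, g, hg⟩ := Module.Finite.exists_fin' R Y
    have hinj := LinearMap.lcomp_injective_of_surjective (S := R) (N := X) g hg
    have hXa : DepthGE R d ((Fin a → R) →ₗ[R] X) :=
      (hXd.pi a).of_linearEquiv (LinearEquiv.piRing R X (Fin a) R).symm
    obtain _ | i := i
    · exact of_exact_snd_left_zero hinj (hXa 0 (by omega))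
    · exact of_exact_snd_left hinj (LinearMap.lcomp_subtype_ker_surjective hX hY hg)
        (LinearMap.exact_lcomp_of_exact_of_surjective X (LinearMap.exact_subtype_ker_map g) hg)
        (hXa _ (by omega)) (ih (by omega) _ ((hR.pi a).ker hg hY) i (by omega))

lemma DepthGE.ker_of_exact {d : ℕ} {a : A →ₗ[R] B} {b : B →ₗ[R] C} (hb : Function.Surjective b)
    (h : Function.Exact a b) (hA : DepthGE R d A) (hB : DepthGE R d B) (hC : DepthGE R d C) :
    DepthGE R d (LinearMap.ker a) := by
  have hI : DepthGE R d (LinearMap.range a) := by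
    rw [← LinearMap.exact_iff.mp h]
    exact hB.ker hb hC
  have := hA.ker a.surjective_rangeRestrict hI
  rwa [LinearMap.ker_rangeRestrict] at this

/-- Dualizing an exact sequence of maximal Cohen–Macaulay modules into the canonical module. -/
lemma exact_lcomp_subtype_ker {d : ℕ} [Module.Finite R X] [Module.Finite R B] [Module.Finite R C]
    (hX : InjBound R d X) {a : A →ₗ[R] B} {b : B →ₗ[R] C} (hb : Function.Surjective b)
    (h : Function.Exact a b) (hB : DepthGE R d B) (hC : DepthGE R d C) :
    Function.Exact (LinearMap.lcomp R X a) (LinearMap.lcomp R X (LinearMap.ker a).subtype) ∧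
    Function.Surjective (LinearMap.lcomp R X (LinearMap.ker a).subtype) := by
  have hI : DepthGE R d (LinearMap.range a) := by
    rw [← LinearMap.exact_iff.mp h]
    exact hB.ker hb hC
  constructor
  · intro φ
    refine ⟨fun hφ ↦ ?_, ?_⟩
    · obtain ⟨ψ, hψ⟩ := (LinearMap.exact_lcomp_of_exact_of_surjective X
        (LinearMap.exact_subtype_ker_map _) a.surjective_rangeRestrict φ).mp (by
          ext ⟨y, hy⟩
          rw [LinearMap.ker_rangeRestrict] at hy
          exact LinearMap.congr_fun hφ ⟨y, hy⟩)
      obtain ⟨χ, hχ⟩ := exists_extension (LinearMap.range a).subtype_injective hb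
        (LinearMap.exact_iff.mpr (by rw [LinearMap.exact_iff.mp h, Submodule.range_subtype]))
        (hX.extVanishes hC (by omega)) ψ
      exact ⟨χ, by rw [← hψ, ← hχ]; rfl⟩
    · rintro ⟨ψ, rfl⟩
      ext y
      change ψ (a y) = 0
      rw [y.2, map_zero]
  · have := LinearMap.lcomp_subtype_ker_surjective hX hI a.surjective_rangeRestrict
    rwa [LinearMap.ker_rangeRestrict] at this

end Dual

section Endomorphisms

open ExtVanishes

variable {R : Type} [CommRing R] [IsNoetherianRing R] [IsLocalRing R] {N Z : Type}
  [AddCommGroup N] [Module R N] [AddCommGroup Z] [Module R Z]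

lemma eq_maximalIdeal_of_ringKrullDim_le_zero {J : Ideal R} (hJ : ringKrullDim (R ⧸ J) ≤ 0)
    (q : PrimeSpectrum R) (hq : J ≤ q.asIdeal) : q.asIdeal = maximalIdeal R := by
  have : Ring.KrullDimLE 0 (R ⧸ J) := Ring.krullDimLE_iff.mpr hJ
  have hsurj : Function.Surjective (Ideal.Quotient.mk J) := Ideal.Quotient.mk_surjective
  have hker : RingHom.ker (Ideal.Quotient.mk J) ≤ q.asIdeal := by rwa [Ideal.mk_ker]
  have h1 : (q.asIdeal.map (Ideal.Quotient.mk J)).IsPrime :=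
    Ideal.map_isPrime_of_surjective hsurj hker
  have h2 : (q.asIdeal.map (Ideal.Quotient.mk J)).IsMaximal := h1.isMaximal'
  have h3 := Ideal.comap_isMaximal_of_surjective (Ideal.Quotient.mk J) hsurj (K := _) (H := h2)
  rw [Ideal.comap_map_of_surjective _ hsurj, ← RingHom.ker_eq_comap_bot, sup_eq_left.mpr hker] at h3
  exact eq_maximalIdeal h3

lemma length_linearMap_le [Module.Finite R N] {J : Ideal R} (hJ : ringKrullDim (R ⧸ J) ≤ 0)
    (hcyc : ∃ φ₀ : R ⧸ maximalIdeal R →ₗ[R] Z, ∀ φ : R ⧸ maximalIdeal R →ₗ[R] Z, ∃ r : R,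
      φ = r • φ₀) (hN : J ≤ Module.annihilator R N) :
    Module.length R (N →ₗ[R] Z) ≤ Module.length R N := by
  induction ‹Module.Finite R N› using
    IsNoetherianRing.induction_on_isQuotientEquivQuotientPrime R with
  | subsingleton N =>
    have : Subsingleton (N →ₗ[R] Z) := ⟨fun f g ↦ LinearMap.ext fun x ↦ by
      rw [Subsingleton.elim x 0, map_zero, map_zero]⟩
    rw [Module.length_eq_zero]
    exact zero_le
  | quotient N p f =>
    rw [f.annihilator_eq, Ideal.annihilator_quotient] at hN
    rw [(f.congrLeft Z R).length_eq, f.length_eq,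
      eq_maximalIdeal_of_ringKrullDim_le_zero hJ p hN]
    obtain ⟨φ₀, hφ₀⟩ := hcyc
    refine Module.length_le_of_surjective ((maximalIdeal R).liftQ
      (LinearMap.toSpanSingleton R _ φ₀) ?_) ?_
    · intro x hx
      refine LinearMap.mem_ker.mpr (LinearMap.ext fun z ↦ ?_)
      rw [LinearMap.toSpanSingleton_apply, LinearMap.smul_apply, ← map_smul,
        smul_residue_eq_zero hx, map_zero, LinearMap.zero_apply]
    · intro φ
      obtain ⟨r, rfl⟩ := hφ₀ φ
      exact ⟨Submodule.Quotient.mk r, rfl⟩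
  | exact N₁ N₂ N₃ f g hf hg hfg h₁ h₃ =>
    rw [Module.length_eq_add_of_exact f g hf hg hfg,
      Module.length_eq_add_of_exact (LinearMap.lcomp R Z g) (LinearMap.lcomp R Z f).rangeRestrict
        (LinearMap.lcomp_injective_of_surjective g hg) (LinearMap.surjective_rangeRestrict _)
        (LinearMap.exact_iff.mpr (by
          rw [LinearMap.ker_rangeRestrict, LinearMap.exact_iff.mp
            (LinearMap.exact_lcomp_of_exact_of_surjective Z hfg hg)])), add_comm]
    refine add_le_add ((Module.length_le_of_injective _ (Submodule.subtype_injective _)).trans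
      (h₁ (hN.trans (f.annihilator_le_of_injective hf))))
      (h₃ (hN.trans (g.annihilator_le_of_surjective hg)))

/-- `Z` is faithful over `R ⧸ J` and all its endomorphisms are homotheties. -/
abbrev IsHomothetic (J : Ideal R) (Z : Type) [AddCommGroup Z] [Module R Z] : Prop :=
  Module.annihilator R Z ≤ J ∧ ∀ φ : Z →ₗ[R] Z, ∃ r : R, ∀ z, φ z = r • z

lemma IsHomothetic.of_ringKrullDim_le_zero [Module.Finite R Z] {J : Ideal R}
    (hJ : ringKrullDim (R ⧸ J) ≤ 0) (hZ : J ≤ Module.annihilator R Z)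
    (hne : ∃ φ : R ⧸ maximalIdeal R →ₗ[R] Z, φ ≠ 0)
    (hcyc : ∃ φ₀ : R ⧸ maximalIdeal R →ₗ[R] Z, ∀ φ : R ⧸ maximalIdeal R →ₗ[R] Z, ∃ r : R,
      φ = r • φ₀)
    (hext : ∀ (N' N : Type) [AddCommGroup N'] [Module R N'] [AddCommGroup N] [Module R N]
      [Module.Finite R N] (i : N' →ₗ[R] N), Function.Injective i → J ≤ Module.annihilator R N →
      (∃ a, maximalIdeal R ^ a ≤ Module.annihilator R N) → ∀ φ : N' →ₗ[R] Z,
      ∃ ψ : N →ₗ[R] Z, ψ ∘ₗ i = φ) : IsHomothetic J Z := by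
  obtain ⟨a, ha⟩ : ∃ a, maximalIdeal R ^ a ≤ J := by
    refine Ideal.exists_pow_le_of_le_radical_of_fg ?_ (IsNoetherian.noetherian _)
    rw [Ideal.radical_eq_sInf]
    exact le_sInf fun q hq ↦ (eq_maximalIdeal_of_ringKrullDim_le_zero hJ ⟨q, hq.2⟩ hq.1).ge
  have hann : Module.annihilator R Z ≤ J := by
    intro r hr
    by_contra hrJ
    set u := LinearMap.toSpanSingleton R (R ⧸ J) (Ideal.Quotient.mk J r) with hu
    have hker : LinearMap.ker u ≤ maximalIdeal R := by
      refine le_maximalIdeal fun h ↦ hrJ ?_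
      have : u 1 = 0 := LinearMap.mem_ker.mp (h ▸ Submodule.mem_top)
      rwa [hu, LinearMap.toSpanSingleton_apply, one_smul, Ideal.Quotient.eq_zero_iff_mem] at this
    obtain ⟨φ, hφ⟩ := hne
    obtain ⟨ψ, hψ⟩ := hext (R ⧸ LinearMap.ker u) (R ⧸ J) ((LinearMap.ker u).liftQ u le_rfl)
      (LinearMap.ker_eq_bot.mp (Submodule.ker_liftQ_eq_bot _ _ _ le_rfl))
      Ideal.annihilator_quotient.ge ⟨a, by rwa [Ideal.annihilator_quotient]⟩
      (φ ∘ₗ Submodule.factor hker)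
    apply hφ
    ext
    have h1 := LinearMap.congr_fun hψ (Submodule.Quotient.mk 1)
    have h2 : (LinearMap.ker u).liftQ u le_rfl (Submodule.Quotient.mk 1) =
        r • (1 : R ⧸ J) := by
      rw [Submodule.liftQ_apply, hu, LinearMap.toSpanSingleton_apply, one_smul, Algebra.smul_def,
        mul_one]
      rfl
    rw [LinearMap.comp_apply, h2, map_smul, Module.mem_annihilator.mp hr] at h1
    exact h1.symm
  refine ⟨hann, fun φ ↦ ?_⟩
  have : Ring.KrullDimLE 0 (R ⧸ J) := Ring.krullDimLE_iff.mpr hJ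
  have : IsArtinianRing (R ⧸ J) := isArtinianRing_iff_krullDimLE_zero.mpr this
  have : IsArtinian R (R ⧸ J) := isArtinian_of_surjective_algebraMap (S := R) (R := R ⧸ J)
    Ideal.Quotient.mk_surjective
  let h : R ⧸ J →ₗ[R] (Z →ₗ[R] Z) := J.liftQ (LinearMap.lsmul R Z) fun r hr ↦
    LinearMap.ext fun z ↦ Module.mem_annihilator.mp (hZ hr) z
  have hinj : Function.Injective h := by
    refine LinearMap.ker_eq_bot.mp (Submodule.ker_liftQ_eq_bot _ _ _ fun r hr ↦ hann ?_)
    exact Module.mem_annihilator.mpr fun z ↦ LinearMap.congr_fun hr z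
  have h1 : Module.length R (Z →ₗ[R] Z) ≤ Module.length R Z := length_linearMap_le hJ hcyc hZ
  have h2 : Module.length R Z ≤ Module.length R (R ⧸ J →ₗ[R] Z) := by
    refine Module.length_le_of_surjective (LinearMap.applyₗ (1 : R ⧸ J)) fun z ↦
      ⟨J.liftQ (LinearMap.toSpanSingleton R Z z) fun r hr ↦ ?_, ?_⟩
    · exact Module.mem_annihilator.mp (hZ hr) z
    · exact one_smul R z
  have h3 : Module.length R (R ⧸ J →ₗ[R] Z) ≤ Module.length R (R ⧸ J) :=
    length_linearMap_le hJ hcyc Ideal.annihilator_quotient.ge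
  have h4 := h1.trans (h2.trans h3)
  have hfin : Module.length R (Z →ₗ[R] Z) ≠ ⊤ :=
    ne_top_of_le_ne_top Module.length_ne_top h4
  obtain ⟨_, _⟩ := isFiniteLength_iff_isNoetherian_isArtinian.mp (Module.length_ne_top_iff.mp hfin)
  have hsurj : LinearMap.range h = ⊤ := by
    by_contra hne
    refine (Submodule.length_lt hne).not_ge (h4.trans ?_)
    exact (LinearEquiv.ofInjective h hinj).length_eq.le
  obtain ⟨r, hr⟩ := LinearMap.range_eq_top.mp hsurj φ
  obtain ⟨r, rfl⟩ := Ideal.Quotient.mk_surjective r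
  exact ⟨r, fun z ↦ by rw [← hr]; rfl⟩

/-- Homotheticity lifts along a regular element. -/
lemma IsHomothetic.of_quotSMul [Module.Finite R Z] {J : Ideal R} {x : R} (hx : x ∈ maximalIdeal R)
    (hreg : IsSMulRegular Z x) (hZ : J ≤ Module.annihilator R Z)
    (h : IsHomothetic (J ⊔ Ideal.span {x}) (quotSMul x Z)) : IsHomothetic J Z := by
  constructor
  · refine Submodule.le_of_le_smul_of_le_jacobson_bot (IsNoetherian.noetherian _)
      (maximalIdeal_le_jacobson ⊥) fun r hr ↦ ?_
    obtain ⟨s, hs, y, hy, rfl⟩ := Submodule.mem_sup.mp (h.1 ((Submodule.mkQ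
      (LinearMap.range (LinearMap.lsmul R Z x))).annihilator_le_of_surjective
      (Submodule.mkQ_surjective _) hr))
    obtain ⟨t, rfl⟩ := Ideal.mem_span_singleton'.mp hy
    refine Submodule.add_mem_sup hs ?_
    rw [mul_comm]
    refine Submodule.smul_mem_smul hx (Module.mem_annihilator.mpr fun z ↦ hreg ?_)
    have := Module.mem_annihilator.mp hr z
    rw [add_smul, Module.mem_annihilator.mp (hZ hs), zero_add, mul_comm, mul_smul] at this
    simpa using! this
  · have key : (⊤ : Submodule R (Z →ₗ[R] Z)) ≤ LinearMap.range (LinearMap.lsmul R Z) := by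
      refine Submodule.le_of_le_smul_of_le_jacobson_bot (IsNoetherian.noetherian _)
        (maximalIdeal_le_jacobson ⊥) fun φ _ ↦ ?_
      have hφ : LinearMap.range (LinearMap.lsmul R Z x) ≤
          (LinearMap.range (LinearMap.lsmul R Z x)).comap φ := by
        rintro _ ⟨z, rfl⟩
        exact ⟨φ z, (map_smul φ x z).symm⟩
      obtain ⟨r, hr⟩ := h.2 (Submodule.mapQ _ _ φ hφ)
      have hmem : ∀ z, (φ - LinearMap.lsmul R Z r) z ∈ LinearMap.range (LinearMap.lsmul R Z x) := by
        intro z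
        exact (Submodule.Quotient.eq _).mp (hr (Submodule.Quotient.mk z))
      let ψ : Z →ₗ[R] Z := (LinearEquiv.ofInjective _ (lsmul_injective hreg)).symm.toLinearMap ∘ₗ
        (φ - LinearMap.lsmul R Z r).codRestrict _ hmem
      have hψ : φ = LinearMap.lsmul R Z r + x • ψ := by
        ext z
        have : x • ψ z = (φ - LinearMap.lsmul R Z r) z :=
          congrArg Subtype.val ((LinearEquiv.ofInjective _ (lsmul_injective hreg)).apply_symm_apply
            ((φ - LinearMap.lsmul R Z r).codRestrict _ hmem z))
        rw [LinearMap.add_apply, LinearMap.smul_apply, this]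
        simp
      rw [hψ]
      exact Submodule.add_mem_sup ⟨r, rfl⟩ (Submodule.smul_mem_smul hx trivial)
    intro φ
    obtain ⟨r, rfl⟩ := key (Submodule.mem_top (x := φ))
    exact ⟨r, fun z ↦ rfl⟩

end Endomorphisms

section Homothety

open ExtVanishes

variable {R : Type} [CommRing R] [IsNoetherianRing R] [IsLocalRing R] {N Z : Type}
  [AddCommGroup N] [Module R N] [AddCommGroup Z] [Module R Z]

/-- The connecting homomorphism `Ext^t(N, Z/xZ) → Ext^(t+1)(N, Z)`. -/
noncomputable abbrev connecting (N : Type) [AddCommGroup N] [Module R N] {x : R}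
    (hreg : IsSMulRegular Z x) {t : ℕ}
    (α : Abelian.Ext (ModuleCat.of R N) (ModuleCat.of R (quotSMul x Z)) t) :
    Abelian.Ext (ModuleCat.of R N) (ModuleCat.of R Z) (t + 1) :=
  α.comp (exists_shortExact (lsmul_injective hreg) (Submodule.mkQ_surjective _)
    (exact_lsmul_mkQ x)).extClass rfl

lemma connecting_surjective {x : R} (hreg : IsSMulRegular Z x) (hx : ∀ n : N, x • n = 0) (t : ℕ) :
    Function.Surjective (connecting N hreg (t := t)) :=
  fun α ↦ Abelian.Ext.covariant_sequence_exact₁ (ModuleCat.of R N)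
    (exists_shortExact (lsmul_injective hreg) (Submodule.mkQ_surjective _) (exact_lsmul_mkQ x)) α
    ((smul_comp_mk₀_lsmul x α).trans (smul_eq_zero_of_annihilates hx α)) rfl

lemma connecting_injective {x : R} (hreg : IsSMulRegular Z x) {t : ℕ} (h : ExtVanishes R N Z t) :
    Function.Injective (connecting N hreg (t := t)) := by
  intro α β hαβ
  obtain ⟨γ, hγ⟩ := Abelian.Ext.covariant_sequence_exact₃ (ModuleCat.of R N)
    (exists_shortExact (lsmul_injective hreg) (Submodule.mkQ_surjective _) (exact_lsmul_mkQ x))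
    (α - β) rfl (by
      rw [sub_eq_add_neg, Abelian.Ext.add_comp, Abelian.Ext.neg_comp]
      exact add_neg_eq_zero.mpr hαβ)
  rw [@Subsingleton.elim _ h γ 0, Abelian.Ext.zero_comp] at hγ
  exact sub_eq_zero.mp hγ.symm

/-- The data propagated along a regular sequence from a canonical module down to the artinian
case. -/
structure CanonicalLike (R : Type) [CommRing R] [IsLocalRing R] (t : ℕ) (J : Ideal R) (Z : Type)
    [AddCommGroup Z] [Module R Z] : Prop where
  finite : Module.Finite R Z
  le_annihilator : J ≤ Module.annihilator R Z
  depth : DepthGE R t Z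
  depth_ring : DepthGE R t (R ⧸ J)
  dim : ringKrullDim (R ⧸ J) ≤ t
  nontrivial : ¬ ExtVanishes R (R ⧸ maximalIdeal R) Z t
  cyclic : ∃ α : Abelian.Ext (ModuleCat.of R (R ⧸ maximalIdeal R)) (ModuleCat.of R Z) t,
    ∀ β, ∃ r : R, β = r • α
  extend : ∀ (N' N : Type) [AddCommGroup N'] [Module R N'] [AddCommGroup N] [Module R N]
    [Module.Finite R N] (i : N' →ₗ[R] N), Function.Injective i → J ≤ Module.annihilator R N →
    (∃ a, maximalIdeal R ^ a ≤ Module.annihilator R N) →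
    ∀ α : Abelian.Ext (ModuleCat.of R N') (ModuleCat.of R Z) t,
    ∃ β : Abelian.Ext (ModuleCat.of R N) (ModuleCat.of R Z) t,
      (Abelian.Ext.mk₀ (ModuleCat.ofHom i)).comp β (zero_add t) = α

lemma ringKrullDim_quotient_sup_span_le {J : Ideal R} {x : R} {t : ℕ}
    (hreg : IsSMulRegular (R ⧸ J) x) (h : ringKrullDim (R ⧸ J) ≤ (t + 1 : ℕ)) :
    ringKrullDim (R ⧸ J ⊔ Ideal.span {x}) ≤ t := by
  have hx : Ideal.Quotient.mk J x ∈ nonZeroDivisors (R ⧸ J) := by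
    rw [mem_nonZeroDivisors_iff_right]
    intro y hy
    refine hreg ?_
    simpa [Algebra.smul_def, mul_comm] using hy
  have h1 := (ringKrullDim_quotient_succ_le_of_nonZeroDivisor hx).trans h
  have e := DoubleQuot.quotQuotEquivQuotSup J (Ideal.span {x})
  rw [← ringKrullDim_eq_of_ringEquiv e, Ideal.map_span, Set.image_singleton]
  rw [Nat.cast_add, Nat.cast_one] at h1
  exact ENat.WithBot.add_le_add_one_right_iff.mp h1

lemma DepthGE.quotient_sup_span {J : Ideal R} {x : R} {t : ℕ} (hreg : IsSMulRegular (R ⧸ J) x)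
    (h : DepthGE R (t + 1) (R ⧸ J)) : DepthGE R t (R ⧸ J ⊔ Ideal.span {x}) := by
  intro i hi
  refine of_exact_snd_right (lsmul_injective hreg)
    (g := Submodule.factor (le_sup_left : J ≤ J ⊔ Ideal.span {x}))
    (Submodule.factor_surjective _) (fun y ↦ ?_) (h i (by omega)) (h (i + 1) (by omega))
  obtain ⟨y, rfl⟩ := Submodule.Quotient.mk_surjective _ y
  have h1 : Submodule.factor (le_sup_left : J ≤ J ⊔ Ideal.span {x}) (Submodule.Quotient.mk y) = 0 ↔
      y ∈ J ⊔ Ideal.span {x} := Submodule.Quotient.mk_eq_zero _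
  rw [h1, Submodule.mem_sup]
  constructor
  · rintro ⟨s, hs, z, hz, rfl⟩
    obtain ⟨u, rfl⟩ := Ideal.mem_span_singleton'.mp hz
    refine ⟨Submodule.Quotient.mk u, (Submodule.Quotient.eq J).mpr ?_⟩
    change x * u - (s + u * x) ∈ J
    rw [mul_comm u x, sub_add_cancel_right]
    exact J.neg_mem hs
  · rintro ⟨u, hu⟩
    obtain ⟨u, rfl⟩ := Submodule.Quotient.mk_surjective _ u
    have h2 := (Submodule.Quotient.eq J).mp hu
    refine ⟨_, J.neg_mem h2, x • u, Ideal.mul_mem_right _ _ (Ideal.mem_span_singleton_self x), ?_⟩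
    abel

lemma CanonicalLike.exists_quotSMul {t : ℕ} {J : Ideal R} (h : CanonicalLike R (t + 1) J Z) :
    ∃ x ∈ maximalIdeal R, IsSMulRegular Z x ∧
      CanonicalLike R t (J ⊔ Ideal.span {x}) (quotSMul x Z) := by
  have := h.finite
  obtain ⟨x, hx, hreg⟩ := exists_isSMulRegular (Y := Z × R ⧸ J)
    (prod_snd (h.depth 0 (by omega)) (h.depth_ring 0 (by omega)))
  have hZ : IsSMulRegular Z x := fun a b hab ↦
    congrArg Prod.fst (hreg (a₁ := (a, 0)) (a₂ := (b, 0)) (Prod.ext hab rfl))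
  have hJ : IsSMulRegular (R ⧸ J) x := fun a b hab ↦
    congrArg Prod.snd (hreg (a₁ := (0, a)) (a₂ := (0, b)) (Prod.ext rfl hab))
  have hxk := smul_residue_eq_zero hx
  refine ⟨x, hx, hZ, inferInstance, sup_span_le_annihilator J h.le_annihilator x,
    h.depth.quotSMul hZ, h.depth_ring.quotient_sup_span hJ,
    ringKrullDim_quotient_sup_span_le hJ h.dim,
    fun H ↦ h.nontrivial (succ_of_quotSMul_snd hxk hZ H), ?_, ?_⟩
  · obtain ⟨α, hα⟩ := h.cyclic
    obtain ⟨α, rfl⟩ := connecting_surjective hZ hxk t α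
    refine ⟨α, fun β ↦ ?_⟩
    obtain ⟨r, hr⟩ := hα (connecting _ hZ β)
    refine ⟨r, connecting_injective hZ (h.depth t (by omega)) (hr.trans ?_)⟩
    exact (Abelian.Ext.smul_comp _ _ _ _).symm
  · intro N' N _ _ _ _ _ i hi hJN ⟨a, ha⟩ α
    have hxN : ∀ n : N, x • n = 0 := fun n ↦ Module.mem_annihilator.mp
      (hJN (Ideal.mem_sup_right (Ideal.mem_span_singleton_self x))) n
    have : Module.Finite R N' := Module.Finite.of_injective i hi
    obtain ⟨β, hβ⟩ := h.extend N' N i hi (le_sup_left.trans hJN) ⟨a, ha⟩ (connecting N' hZ α)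
    obtain ⟨β, rfl⟩ := connecting_surjective hZ hxN t β
    refine ⟨β, connecting_injective hZ (of_pow_maximalIdeal_le (h.depth t (by omega))
      (ha.trans (i.annihilator_le_of_injective hi))) (Eq.trans ?_ hβ)⟩
    exact Abelian.Ext.comp_assoc _ _ _ _ _ (by omega)

lemma CanonicalLike.isHomothetic {t : ℕ} {J : Ideal R} (h : CanonicalLike R t J Z) :
    IsHomothetic J Z := by
  induction t generalizing J Z with
  | zero =>
    have := h.finite
    have e := zeroEquiv R (R ⧸ maximalIdeal R) Z
    refine .of_ringKrullDim_le_zero h.dim h.le_annihilator ?_ ?_ ?_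
    · have := h.nontrivial
      rw [zero_iff, not_subsingleton_iff_nontrivial] at this
      exact exists_ne 0
    · obtain ⟨α, hα⟩ := h.cyclic
      refine ⟨e α, fun φ ↦ ?_⟩
      obtain ⟨r, hr⟩ := hα (e.symm φ)
      exact ⟨r, by rw [← map_smul, ← hr, e.apply_symm_apply]⟩
    · intro N' N _ _ _ _ _ i hi hJ ha φ
      obtain ⟨β, hβ⟩ := h.extend N' N i hi hJ ha (Abelian.Ext.mk₀ (ModuleCat.ofHom φ))
      obtain ⟨ψ, rfl⟩ := (Abelian.Ext.mk₀_bijective _ _).2 β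
      refine ⟨ψ.hom, ?_⟩
      rw [Abelian.Ext.mk₀_comp_mk₀] at hβ
      exact congrArg ModuleCat.Hom.hom ((Abelian.Ext.mk₀_bijective _ _).1 hβ)
  | succ t ih =>
    have := h.finite
    obtain ⟨x, hx, hreg, h'⟩ := h.exists_quotSMul
    exact .of_quotSMul hx hreg h.le_annihilator (ih h')

/-- The homothety map `R → Hom(ω, ω)` is bijective. -/
lemma lsmul_bijective_of_canonical [Module.Finite R Z] {d : ℕ} (hdim : ringKrullDim R ≤ d)
    (hR : DepthGE R d R) (hZ : DepthGE R d Z) (hinj : InjBound R d Z)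
    (e : Abelian.Ext (ModuleCat.of R (R ⧸ maximalIdeal R)) (ModuleCat.of R Z) d ≃ₗ[R]
      R ⧸ maximalIdeal R) : Function.Bijective (LinearMap.lsmul R Z) := by
  have h : CanonicalLike R d ⊥ Z := by
    have e' : (R ⧸ (⊥ : Ideal R)) ≃ₗ[R] R := Submodule.quotEquivOfEqBot ⊥ rfl
    refine ⟨‹_›, bot_le, hZ, hR.of_linearEquiv e'.symm, ?_, ?_, ⟨e.symm 1, fun β ↦ ?_⟩, ?_⟩
    · rwa [ringKrullDim_eq_of_ringEquiv (RingEquiv.quotientBot R)]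
    · intro H
      exact not_subsingleton (R ⧸ maximalIdeal R) e.symm.toEquiv.subsingleton
    · obtain ⟨r, hr⟩ := Ideal.Quotient.mk_surjective (e β)
      refine ⟨r, e.injective ?_⟩
      rw [map_smul, e.apply_symm_apply, ← hr, Algebra.smul_def, mul_one]
      rfl
    · intro N' N _ _ _ _ _ i hi _ _ α
      obtain ⟨β, hβ⟩ := Abelian.Ext.contravariant_sequence_exact₁ (exists_shortExact hi
        (Submodule.mkQ_surjective _) (LinearMap.exact_map_mkQ_range i)) (ModuleCat.of R Z) α
        (add_comm 1 d) (@Subsingleton.elim _ (hinj _ (d + 1) (by omega)) _ _)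
      exact ⟨β, hβ⟩
  have := h.isHomothetic
  constructor
  · rw [← LinearMap.ker_eq_bot, eq_bot_iff]
    exact fun r hr ↦ this.1 (Module.mem_annihilator.mpr fun z ↦ LinearMap.congr_fun hr z)
  · intro φ
    obtain ⟨r, hr⟩ := this.2 φ
    exact ⟨r, LinearMap.ext fun z ↦ (hr z).symm⟩

end Homothety

section Transpose

variable {R : Type} [CommRing R]

lemma nonempty_linearEquiv_of_exact {A B C A' B' C' : Type} [AddCommGroup A] [Module R A]
    [AddCommGroup B] [Module R B] [AddCommGroup C] [Module R C] [AddCommGroup A'] [Module R A']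
    [AddCommGroup B'] [Module R B'] [AddCommGroup C'] [Module R C'] {a : A →ₗ[R] B}
    {c : B →ₗ[R] C} {a' : A' →ₗ[R] B'} {c' : B' →ₗ[R] C'} (h : Function.Exact a c)
    (hc : Function.Surjective c) (h' : Function.Exact a' c') (hc' : Function.Surjective c')
    (eA : A ≃ₗ[R] A') (eB : B ≃ₗ[R] B') (comm : eB.toLinearMap ∘ₗ a = a' ∘ₗ eA.toLinearMap) :
    Nonempty (C ≃ₗ[R] C') :=
  ⟨(h.linearEquivOfSurjective hc).symm.trans <|
    (Submodule.Quotient.equiv _ _ eB (by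
      rw [← LinearMap.range_comp, comm, LinearMap.range_comp,
        LinearEquiv.range, Submodule.map_top])).trans (h'.linearEquivOfSurjective hc')⟩

variable (n : ℕ) (ω : Type) [AddCommGroup ω] [Module R ω]

/-- The canonical isomorphism `F ⊗ ω ≃ Hom(F*, ω)` for a finite free module `F`. -/
noncomputable def tensorEquivHomDual :
    (Fin n → R) ⊗[R] ω ≃ₗ[R] (Module.Dual R (Fin n → R) →ₗ[R] ω) :=
  (TensorProduct.congr (Module.evalEquiv R (Fin n → R)) (LinearEquiv.refl R ω)).trans
    (dualTensorHomEquiv R (Module.Dual R (Fin n → R)) ω)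

lemma tensorEquivHomDual_tmul (v : Fin n → R) (w : ω) (φ : Module.Dual R (Fin n → R)) :
    tensorEquivHomDual n ω (v ⊗ₜ w) φ = φ v • w := by
  simp [tensorEquivHomDual]

/-- The canonical isomorphism `F* ≃ Hom(F ⊗ ω, ω)` when `R ≃ Hom(ω, ω)`. -/
noncomputable def dualEquivHomTensor (h : Function.Bijective (LinearMap.lsmul R ω))
    (F : Type) [AddCommGroup F] [Module R F] :
    Module.Dual R F ≃ₗ[R] (F ⊗[R] ω →ₗ[R] ω) :=
  (LinearEquiv.congrRight (LinearEquiv.ofBijective _ h)).trans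
    (TensorProduct.lift.equiv (.id R) F ω ω)

/-- The isomorphism `R^n ⊗ ω ≃ ω^n`. -/
noncomputable def freeTensorEquiv : (Fin n → R) ⊗[R] ω ≃ₗ[R] (Fin n → ω) :=
  (TensorProduct.comm R _ _).trans (TensorProduct.piScalarRight R R ω (Fin n))

variable {n ω}

lemma depthGE_transpose_iff [IsNoetherianRing R] [IsLocalRing R] [Module.Finite R ω] {d : ℕ}
    (hdim : ringKrullDim R ≤ d) (hR : DepthGE R d R) (hω : DepthGE R d ω) (hinj : InjBound R d ω)
    (e : Abelian.Ext (ModuleCat.of R (R ⧸ maximalIdeal R)) (ModuleCat.of R ω) d ≃ₗ[R]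
      R ⧸ maximalIdeal R) {m : ℕ} (f : (Fin n → R) →ₗ[R] (Fin m → R))
    {M T : Type} [AddCommGroup M] [Module R M] [AddCommGroup T] [Module R T]
    (eM : ((Fin m → R) ⧸ LinearMap.range f) ≃ₗ[R] M)
    (eT : (Module.Dual R (Fin n → R) ⧸ LinearMap.range f.dualMap) ≃ₗ[R] T) :
    DepthGE R d T ↔ DepthGE R d (M ⊗[R] ω) := by
  have hend := lsmul_bijective_of_canonical hdim hR hω hinj e
  have hdual : ∀ l, DepthGE R d (Module.Dual R (Fin l → R)) := fun l ↦
    (hR.pi l).of_linearEquiv (LinearEquiv.piRing R R (Fin l) R).symm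
  have htensor : ∀ l, DepthGE R d ((Fin l → R) ⊗[R] ω) := fun l ↦
    (hω.pi l).of_linearEquiv (freeTensorEquiv l ω).symm
  have hg := Submodule.mkQ_surjective (LinearMap.range f)
  have hex := LinearMap.exact_map_mkQ_range f
  have hrT := rTensor_exact ω hex hg
  have hrTs := LinearMap.rTensor_surjective ω hg
  have hdT := LinearMap.exact_map_mkQ_range f.dualMap
  have hdTs := Submodule.mkQ_surjective (LinearMap.range f.dualMap)
  constructor
  · intro hT
    have hC := hT.of_linearEquiv eT.symm
    obtain ⟨h1, h2⟩ := exact_lcomp_subtype_ker hinj hdTs hdT (hdual n) hC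
    obtain ⟨e'⟩ := nonempty_linearEquiv_of_exact hrT hrTs h1 h2 (tensorEquivHomDual n ω)
      (tensorEquivHomDual m ω) (by
        refine TensorProduct.ext' fun v w ↦ LinearMap.ext fun φ ↦ ?_
        exact (tensorEquivHomDual_tmul m ω (f v) w φ).trans
          (tensorEquivHomDual_tmul n ω v w (f.dualMap φ)).symm)
    have hK := DepthGE.linearMap hinj hω hR (DepthGE.ker_of_exact hdTs hdT (hdual m) (hdual n) hC)
    exact (hK.of_linearEquiv e'.symm).of_linearEquiv
      (TensorProduct.congr eM (LinearEquiv.refl R ω))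
  · intro hM
    have hC := hM.of_linearEquiv (TensorProduct.congr eM (LinearEquiv.refl R ω)).symm
    obtain ⟨h1, h2⟩ := exact_lcomp_subtype_ker hinj hrTs hrT (htensor m) hC
    obtain ⟨e'⟩ := nonempty_linearEquiv_of_exact hdT hdTs h1 h2 (dualEquivHomTensor ω hend _)
      (dualEquivHomTensor ω hend _) (by
        refine LinearMap.ext fun φ ↦ TensorProduct.ext' fun v w ↦ ?_
        rfl)
    have hK := DepthGE.linearMap hinj hω hR
      (DepthGE.ker_of_exact hrTs hrT (htensor n) (htensor m) hC)
    exact (hK.of_linearEquiv e'.symm).of_linearEquiv eT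

end Transpose

lemma CategoryTheory.ProjectiveResolution.extMk_zero_degree_eq_zero_iff {R : Type} [CommRing R]
    {X Y : ModuleCat.{0} R} (P : ProjectiveResolution X) (f : P.complex.X 0 ⟶ Y)
    (hf : P.complex.d 1 0 ≫ f = 0) : P.extMk f 1 rfl hf = 0 ↔ f = 0 := by
  refine ⟨fun h ↦ ?_, fun h ↦ by subst h; simp⟩
  rw [← P.extEquivCohomologyClass.apply_eq_iff_eq, P.extEquivCohomologyClass_extMk,
    P.extEquivCohomologyClass_zero, CochainComplex.HomComplex.CohomologyClass.mk_eq_zero_iff,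
    CochainComplex.HomComplex.Cocycle.toSingleMk_mem_coboundaries_iff _ _ _ _ _ 1 (by simp)] at h
  obtain ⟨g, hg⟩ := h
  have h0 : P.cochainComplex.d (-(0 : ℕ) : ℤ) 1 = 0 :=
    (P.cochainComplex.isZero_of_isStrictlyLE 0 1).eq_of_tgt _ _
  rw [h0, Limits.zero_comp] at hg
  rw [← cancel_epi (P.cochainComplexXIso (-(0 : ℕ) : ℤ) 0 rfl).hom, ← hg, Limits.comp_zero]

section

variable (R : Type) [CommRing R]

lemma extMk_smul {X Y : ModuleCat.{0} R} (P : ProjectiveResolution X) {n : ℕ}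
    (f : P.complex.X n ⟶ Y) (m : ℕ) (hm : n + 1 = m) (hf : P.complex.d m n ≫ f = 0) (r : R) :
    P.extMk (r • f) m hm (by simp [hf]) = r • P.extMk f m hm hf := by
  have := P.extMk_comp_mk₀ f m hm hf (ModuleCat.ofHom (LinearMap.lsmul R Y r))
  rw [show (ModuleCat.ofHom (LinearMap.lsmul R Y r)) = r • 𝟙 Y from rfl] at this
  rw [Abelian.Ext.mk₀_smul, Abelian.Ext.comp_smul, Abelian.Ext.comp_mk₀_id] at this
  rw [this]
  congr 1

/-- The linear map sending a cocycle on a projective resolution to its class in `Ext`. -/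
noncomputable def cocycleToExt {X Y : ModuleCat.{0} R} (P : ProjectiveResolution X) (n i : ℕ) :
    LinearMap.ker ((P.complex.linearYonedaObj R Y).sc' i n (n + 1)).g.hom →ₗ[R]
      Abelian.Ext X Y n where
  toFun x := P.extMk x.1 (n + 1) rfl x.2
  map_add' _ _ := (P.add_extMk _ _ _ _ _ _).symm
  map_smul' r _ := extMk_smul R P _ _ _ _ r

/-- The `Ext` groups defined by derived functors agree with those defined by the derived
category. -/
lemma nonempty_extGroup_linearEquiv (n : ℕ) (N X : Type) [AddCommGroup N] [Module R N]
    [AddCommGroup X] [Module R X] :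
    Nonempty (extGroup R n N X ≃ₗ[R] Abelian.Ext (ModuleCat.of R N) (ModuleCat.of R X) n) := by
  let P := projectiveResolution (ModuleCat.of R N)
  let Y := ModuleCat.of R X
  let K := P.complex.linearYonedaObj R Y
  have key : ∀ i, (ComplexShape.up ℕ).prev n = i →
      LinearMap.ker (cocycleToExt R (Y := Y) P n i) =
        LinearMap.range (K.sc' i n (n + 1)).moduleCatToCycles := by
    intro i hi
    ext ⟨x, hx⟩
    rw [LinearMap.mem_ker]
    change P.extMk x (n + 1) rfl hx = 0 ↔ _
    obtain _ | p := n
    · refine (P.extMk_zero_degree_eq_zero_iff x hx).trans ?_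
      have hf : (K.sc' i 0 (0 + 1)).f = 0 := K.shape _ _ (by simp)
      constructor
      · intro h
        exact ⟨0, (map_zero _).trans (Subtype.ext h.symm)⟩
      · rintro ⟨y, hy⟩
        have := congrArg Subtype.val hy
        change (K.sc' i 0 (0 + 1)).f.hom y = x at this
        rw [hf] at this
        exact this.symm
    · rw [CochainComplex.prev_nat_succ] at hi
      subst hi
      refine (P.extMk_eq_zero_iff x _ rfl hx p rfl).trans ?_
      constructor
      · rintro ⟨g, hg⟩
        exact ⟨g, Subtype.ext hg⟩
      · rintro ⟨g, hg⟩
        exact ⟨g, congrArg Subtype.val hg⟩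
  let i := (ComplexShape.up ℕ).prev n
  have hsurj : Function.Surjective (cocycleToExt R (Y := Y) P n i) := fun α ↦ by
    obtain ⟨f, hf, rfl⟩ := P.extMk_surjective α (n + 1) rfl
    exact ⟨⟨f, hf⟩, rfl⟩
  refine ⟨(P.isoExt n Y ≪≫ ShortComplex.homologyMapIso (K.isoSc' i n (n + 1) rfl (by simp)) ≪≫
    (K.sc' i n (n + 1)).moduleCatHomologyIso).toLinearEquiv ≪≫ₗ
    (Submodule.quotEquivOfEq _ _ (key i rfl).symm) ≪≫ₗ
    (cocycleToExt R (Y := Y) P n i).quotKerEquivOfSurjective hsurj⟩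

variable {R} in
lemma nontrivial_extGroup_iff {n : ℕ} {N X : Type} [AddCommGroup N] [Module R N]
    [AddCommGroup X] [Module R X] :
    Nontrivial (extGroup R n N X) ↔ ¬ ExtVanishes R N X n := by
  obtain ⟨e⟩ := nonempty_extGroup_linearEquiv R n N X
  rw [e.toEquiv.nontrivial_congr, not_subsingleton_iff_nontrivial]

end

section Localization

variable {R : Type} [CommRing R] [IsNoetherianRing R] (S : Submonoid R)

/-- Vanishing of `Ext` from a finite module localizes. -/
lemma ExtVanishes.localizedModule {N X : Type} [AddCommGroup N] [Module R N] [Module.Finite R N]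
    [AddCommGroup X] [Module R X] {j : ℕ} (h : ExtVanishes R N X j) :
    ExtVanishes (Localization S) (LocalizedModule S N) (LocalizedModule S X) j := by
  have hsurj : ∀ (K : Type) [AddCommGroup K] [Module R K] [Module.Finite R K]
      (φ : LocalizedModule S K →ₗ[Localization S] LocalizedModule S X),
      ∃ (s : S) (φ₀ : K →ₗ[R] X), s • φ = LocalizedModule.map S φ₀ := by
    intro K _ _ _ φ
    have := Module.finitePresentation_of_finite R K
    obtain ⟨⟨φ₀, s⟩, hs⟩ := IsLocalizedModule.surj S (LocalizedModule.map S (M := K) (N := X)) φ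
    exact ⟨s, φ₀, hs⟩
  have hunit : ∀ (s : S), IsUnit (algebraMap R (Localization S) s) :=
    fun s ↦ IsLocalization.map_units _ s
  induction j generalizing N with
  | zero =>
    rw [zero_iff] at h ⊢
    refine subsingleton_of_forall_eq 0 fun φ ↦ ?_
    obtain ⟨s, φ₀, hs⟩ := hsurj N φ
    rw [Subsingleton.elim φ₀ 0, map_zero] at hs
    rw [← (hunit s).smul_eq_zero (x := φ)]
    rw [algebraMap_smul]
    exact hs
  | succ j ih =>
    obtain ⟨n, π, hπ⟩ := Module.Finite.exists_fin' R N
    let K := LinearMap.ker π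
    have hex : Function.Exact K.subtype π := LinearMap.exact_subtype_ker_map π
    have hi : Function.Injective (LocalizedModule.map S K.subtype) :=
      IsLocalizedModule.map_injective S _ _ _ K.injective_subtype
    have hs : Function.Surjective (LocalizedModule.map S π) :=
      IsLocalizedModule.map_surjective S _ _ _ hπ
    have he : Function.Exact (LocalizedModule.map S K.subtype) (LocalizedModule.map S π) :=
      LocalizedModule.map_exact S _ _ hex
    have hfree : Module.Projective (Localization S) (LocalizedModule S (Fin n → R)) :=
      inferInstance
    obtain _ | j := j
    · refine one_of_forall_extension (A := LocalizedModule S K) (B := LocalizedModule S (Fin n → R))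
        (f := LocalizedModule.map S K.subtype) hi hs he fun φ ↦ ?_
      obtain ⟨s, φ₀, hφ⟩ := hsurj K φ
      obtain ⟨ψ₀, rfl⟩ := exists_extension K.injective_subtype hπ hex h φ₀
      obtain ⟨u, hu⟩ := hunit s
      refine ⟨(↑u⁻¹ : Localization S) • LocalizedModule.map S ψ₀, ?_⟩
      have hcomp : LocalizedModule.map S ψ₀ ∘ₗ LocalizedModule.map S K.subtype =
          LocalizedModule.map S (ψ₀ ∘ₗ K.subtype) := by
        ext x
        induction x using LocalizedModule.induction_on
        simp
      rw [LinearMap.smul_comp, hcomp, ← hφ]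
      have : s • φ = (u : Localization S) • φ := by rw [hu, algebraMap_smul]; rfl
      rw [this, smul_smul, Units.inv_mul, one_smul]
    · exact of_exact_fst_right hi hs he (of_projective _)
        (ih (of_exact_fst_left K.injective_subtype hπ hex (of_projective _) h))

end Localization

/-- Vanishing of `Ext` can be tested over an isomorphic ring. -/
lemma ExtVanishes.restrictScalars {R S : Type} [CommRing R] [CommRing S] [Algebra R S]
    (hS : Function.Bijective (algebraMap R S)) {N X : Type} [AddCommGroup N] [Module R N]
    [Module S N] [IsScalarTower R S N] [AddCommGroup X] [Module R X] [Module S X]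
    [IsScalarTower R S X] {j : ℕ} (h : ExtVanishes S N X j) : ExtVanishes R N X j := by
  have hlin : ∀ {A B : Type} [AddCommGroup A] [Module R A] [Module S A] [IsScalarTower R S A]
      [AddCommGroup B] [Module R B] [Module S B] [IsScalarTower R S B] (φ : A →ₗ[R] B),
      ∃ ψ : A →ₗ[S] B, ∀ a, ψ a = φ a := by
    intro A B _ _ _ _ _ _ _ _ φ
    refine ⟨{ toFun := φ, map_add' := φ.map_add, map_smul' := fun s a ↦ ?_ }, fun _ ↦ rfl⟩
    obtain ⟨r, rfl⟩ := hS.2 s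
    simp
  induction j generalizing N with
  | zero =>
    rw [zero_iff] at h ⊢
    refine subsingleton_of_forall_eq 0 fun φ ↦ ?_
    obtain ⟨ψ, hψ⟩ := hlin φ
    ext a
    rw [← hψ, Subsingleton.elim ψ 0]
    rfl
  | succ j ih =>
    have : Module.Free R S := Module.Free.of_equiv (LinearEquiv.ofBijective (Algebra.linearMap R S) hS)
    let π : (N →₀ S) →ₗ[S] N := Finsupp.linearCombination S id
    have hπ : Function.Surjective π := Finsupp.linearCombination_id_surjective S N
    let K := LinearMap.ker π
    have hex : Function.Exact K.subtype π := LinearMap.exact_subtype_ker_map π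
    have hex' : Function.Exact (K.subtype.restrictScalars R) (π.restrictScalars R) := hex
    have hi' : Function.Injective (K.subtype.restrictScalars R) := K.injective_subtype
    have hπ' : Function.Surjective (π.restrictScalars R) := hπ
    obtain _ | j := j
    · refine one_of_forall_extension (A := K) (B := N →₀ S) (f := K.subtype.restrictScalars R) hi' hπ' hex' fun φ ↦ ?_
      obtain ⟨φ₁, hφ₁⟩ := hlin (A := K) (B := X) φ
      obtain ⟨ψ, hψ⟩ := exists_extension (A := K) (f := K.subtype) K.injective_subtype hπ hex h φ₁
      refine ⟨ψ.restrictScalars R, ?_⟩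
      ext a
      rw [← hφ₁, ← hψ]
      rfl
    · have hK : ExtVanishes S K X (j + 1) :=
        of_exact_fst_left K.injective_subtype hπ hex (of_projective _) h
      have hF : ExtVanishes R (N →₀ S) X (j + 1 + 1) := of_projective _
      exact of_exact_fst_right (f := K.subtype.restrictScalars R) hi' hπ' hex' hF (ih hK)

lemma moduleDepth_eq_coe_iff {R : Type} [CommRing R] [IsLocalRing R] {X : Type} [AddCommGroup X]
    [Module R X] {d : ℕ} :
    moduleDepth R X = d ↔ DepthGE R d X ∧ ¬ ExtVanishes R (R ⧸ maximalIdeal R) X d := by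
  set s := {n : ℕ∞ | ∃ k : ℕ, n = k ∧ Nontrivial (extGroup R k (R ⧸ maximalIdeal R) X)} with hs
  have hmem : ∀ k : ℕ, (k : ℕ∞) ∈ s ↔ ¬ ExtVanishes R (R ⧸ maximalIdeal R) X k := by
    intro k
    rw [← nontrivial_extGroup_iff]
    refine ⟨fun ⟨l, hl, h⟩ ↦ ?_, fun h ↦ ⟨k, rfl, h⟩⟩
    obtain rfl : k = l := by exact_mod_cast hl
    exact h
  change sInf s = d ↔ _
  constructor
  · intro h
    have hne : s.Nonempty := by
      by_contra hne
      rw [Set.not_nonempty_iff_eq_empty] at hne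
      simp [hne] at h
    refine ⟨fun i hi ↦ ?_, ?_⟩
    · by_contra hV
      have := sInf_le ((hmem i).mpr hV)
      rw [h] at this
      exact absurd (by exact_mod_cast this) (not_le.mpr hi)
    · rw [← hmem, ← h]
      exact csInf_mem hne
  · rintro ⟨h1, h2⟩
    refine le_antisymm (sInf_le ((hmem d).mpr h2)) (le_sInf ?_)
    rintro n ⟨k, rfl, hk⟩
    by_contra hlt
    rw [not_le] at hlt
    exact nontrivial_extGroup_iff.mp hk (h1 k (by exact_mod_cast hlt))

lemma nonempty_residue_localization_linearEquiv {R : Type} [CommRing R] (p : Ideal R) [p.IsPrime] :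
    Nonempty (LocalizedModule p.primeCompl (R ⧸ p) ≃ₗ[Localization.AtPrime p]
      (Localization.AtPrime p ⧸ maximalIdeal (Localization.AtPrime p))) := by
  let A := Localization.AtPrime p
  let e := (IsLocalizedModule.linearEquiv p.primeCompl
    (LocalizedModule.mkLinearMap p.primeCompl (R ⧸ p))
    (Submodule.toLocalizedQuotient' A p.primeCompl (Algebra.linearMap R A) p))
  have h : Submodule.localized' A p.primeCompl (Algebra.linearMap R A) p = maximalIdeal A := by
    rw [Ideal.localized'_eq_map, Localization.AtPrime.map_eq_maximalIdeal]
  exact ⟨(e.extendScalarsOfIsLocalization p.primeCompl A).trans (Submodule.quotEquivOfEq _ _ h)⟩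

section

variable {R : Type} [CommRing R] [IsNoetherianRing R] [IsLocalRing R]

/-- A nonzero finite module of depth at least the dimension has depth equal to the dimension. -/
lemma DepthGE.moduleDepth_eq {X : Type} [AddCommGroup X] [Module R X] [Module.Finite R X]
    [Nontrivial X] {d : ℕ} (hd : ringKrullDim R = d) (h : DepthGE R d X) :
    moduleDepth R X = d := by
  refine moduleDepth_eq_coe_iff.mpr ⟨h, fun hV ↦ not_subsingleton X ?_⟩
  refine ExtVanishes.subsingleton_of_ringKrullDim_lt (R := R) (d := d + 1)
    (hd.trans_lt (by exact_mod_cast Nat.lt_succ_self d)) fun i hi ↦ ?_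
  obtain hi | rfl := Nat.lt_succ_iff_lt_or_eq.mp hi
  exacts [h i hi, hV]

lemma IsMCM.depthGE {X : Type} [AddCommGroup X] [Module R X] {d : ℕ} (hd : ringKrullDim R = d)
    (h : IsMCM R X) : DepthGE R d X := by
  intro i hi
  obtain hX | hX := subsingleton_or_nontrivial X
  · exact ExtVanishes.of_subsingleton_snd
  let m := maximalIdeal R
  let A := Localization.AtPrime m
  have hunits : m.primeCompl ≤ IsUnit.submonoid R := fun x hx ↦ by
    by_contra hx'
    exact hx hx'
  let eA : R ≃ₐ[R] A := IsLocalization.atUnits R m.primeCompl hunits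
  have hA : Function.Bijective (algebraMap R A) := by
    convert eA.bijective
    ext x
    exact (eA.commutes x).symm
  have hloc : ∀ (Y : Type) [AddCommGroup Y] [Module R Y],
      Nonempty (Y ≃ₗ[R] LocalizedModule m.primeCompl Y) := fun Y _ _ ↦
    have := IsLocalization.of_le_isUnit hunits
    have : IsLocalizedModule m.primeCompl (LinearMap.id : Y →ₗ[R] Y) :=
      isLocalizedModule_id m.primeCompl Y R
    ⟨IsLocalizedModule.linearEquiv m.primeCompl LinearMap.id (LocalizedModule.mkLinearMap _ _)⟩
  obtain ⟨eX⟩ := hloc X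
  obtain ⟨ek⟩ := hloc (R ⧸ m)
  have hdepth := h ⟨m, inferInstance⟩ eX.symm.toEquiv.nontrivial
  change (moduleDepth A (LocalizedModule m.primeCompl X) : WithBot ℕ∞) = ringKrullDim A at hdepth
  rw [← ringKrullDim_eq_of_ringEquiv eA.toRingEquiv, hd] at hdepth
  have hV := (moduleDepth_eq_coe_iff.mp (show moduleDepth A _ = d by exact_mod_cast hdepth)).1 i hi
  obtain ⟨e⟩ := nonempty_residue_localization_linearEquiv m
  exact ExtVanishes.of_linearEquiv_fst ek.symm (ExtVanishes.of_linearEquiv_snd eX.symm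
    (ExtVanishes.restrictScalars hA (ExtVanishes.of_linearEquiv_fst e.symm hV)))

lemma DepthGE.isMCM {X : Type} [AddCommGroup X] [Module R X] [Module.Finite R X] {d : ℕ}
    (hd : ringKrullDim R = d) (h : DepthGE R d X) : IsMCM R X := by
  intro p hp
  let A := Localization.AtPrime p.asIdeal
  have hdim : ringKrullDim A = p.asIdeal.height :=
    IsLocalization.AtPrime.ringKrullDim_eq_height p.asIdeal A
  have hle : Order.height p + Order.coheight p ≤ (d : ℕ∞) := by
    have : ((⨆ a : PrimeSpectrum R, Order.height a + Order.coheight a : ℕ∞) : WithBot ℕ∞) = d := by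
      rw [← Order.krullDim_eq_iSup_height_add_coheight_of_nonempty]
      exact hd
    have h2 := le_iSup (fun a : PrimeSpectrum R ↦ Order.height a + Order.coheight a) p
    exact h2.trans_eq (by exact_mod_cast this)
  obtain ⟨t, ht⟩ : ∃ t : ℕ, Order.height p = t := by
    have : Order.height p ≤ (d : ℕ∞) := le_self_add.trans hle
    exact ⟨_, (ENat.natCast_toNat (ne_top_of_le_ne_top (ENat.natCast_ne_top d) this)).symm⟩
  have hheight : p.asIdeal.height = t := by
    rw [← ht]
    exact p.height_eq_orderHeight
  rw [hheight] at hdim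
  change (moduleDepth A _ : WithBot ℕ∞) = ringKrullDim A
  have : DepthGE A t (LocalizedModule p.asIdeal.primeCompl X) := by
    intro i hi
    obtain ⟨e⟩ := nonempty_residue_localization_linearEquiv p.asIdeal
    refine ExtVanishes.of_linearEquiv_fst e (ExtVanishes.localizedModule _ ?_)
    refine ExtVanishes.quotient_prime_of_coheight_lt h p i ?_
    rw [ht] at hle
    refine lt_of_lt_of_le ?_ hle
    have hc : Order.coheight p ≠ ⊤ := by
      intro hc
      rw [hc, add_top] at hle
      exact absurd hle (not_le.mpr (ENat.natCast_lt_top d))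
    exact (ENat.add_lt_add_iff_right hc).mpr (by exact_mod_cast hi)
  rw [hdim, this.moduleDepth_eq hdim]

end

/-- Over a Cohen–Macaulay local ring with canonical module `ω`, the transpose `Tr M` is
maximal Cohen–Macaulay iff `M ⊗ ω` is maximal Cohen–Macaulay. -/
theorem transpose_mcm_iff_tensor_canonical_mcm (R : Type) [CommRing R] [IsNoetherianRing R]
    [IsLocalRing R] (hCM : IsCMLocal R)
    (ω : Type) [AddCommGroup ω] [Module R ω] (hω : IsCanonicalModule R ω)
    (M T : Type) [AddCommGroup M] [Module R M] [Module.Finite R M]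
    [AddCommGroup T] [Module R T]
    (hT : IsAuslanderTranspose R M T) :
    IsMCM R T ↔ IsMCM R (TensorProduct R M ω) := by
  obtain ⟨hfin, hmcm, ⟨n, hn⟩, d, hd, ⟨e⟩⟩ := hω
  obtain ⟨m, n', f, -, -, ⟨eM⟩, ⟨eT⟩⟩ := hT
  have hdepthR : moduleDepth R R = d := by
    unfold IsCMLocal at hCM
    rw [hd] at hCM
    exact_mod_cast hCM
  obtain ⟨hR, hR'⟩ := moduleDepth_eq_coe_iff.mp hdepthR
  have hinj : InjBound R d ω :=
    InjBound.of_depth hR hR' fun N _ _ _ j hj ↦ ExtVanishes.of_hasInjDimLE n ω hn N j hj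
  obtain ⟨e'⟩ := nonempty_extGroup_linearEquiv R d (R ⧸ maximalIdeal R) ω
  have hTfin : Module.Finite R T := Module.Finite.equiv eT
  have key := depthGE_transpose_iff hd.le hR (hmcm.depthGE hd) hinj (e'.symm.trans e) f eM eT
  exact ⟨fun h ↦ (key.mp (h.depthGE hd)).isMCM hd, fun h ↦ (key.mpr (h.depthGE hd)).isMCM hd⟩
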